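/- Let K, L be unital C*-algebras with C*-subalgebras A ⊆ K, B ⊆ L; X = X* ∈ K algebraically free from A; Y = Y* ∈ L algebraically free from B; Ψ : L → K a unital completely positive map with Ψ(B⟨Y⟩) ⊆ A⟨X⟩ and (Ψ⊗Ψ) ∘ ∂_{Y:B} = ∂_{X:A} ∘ Ψ on B⟨Y⟩; assume ∂_{X:A} and ∂_{Y:B} are norm-closable. Then there is a holomorphic map Fₙ : H₊(Mₙ(B)) → H₊(Mₙ(A)) such that Mₙ(Ψ)((Y⊗Iₙ − β)⁻¹) = (X⊗Iₙ − Fₙ(β))⁻¹ for all β ∈ H₊(Mₙ(B)). -/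

import Mathlib

open TensorProduct Filter Topology

attribute [local instance] Matrix.linftyOpNormedAddCommGroup Matrix.linftyOpNormedSpace

section

variable (L : Type*) [Ring L] [Algebra ℂ L] [StarRing L] [PartialOrder L]

/-- The imaginary part `(T - T*)/(2i)`. -/
noncomputable def imPartM {n : ℕ} (T : Matrix (Fin n) (Fin n) L) : Matrix (Fin n) (Fin n) L :=
  (2 * Complex.I)⁻¹ • (T - T.conjTranspose)

/-- Positivity for a matrix over a C*-algebra, in the scalar form:
`Σ_{i,j} v_i* m_{ij} v_j ≥ 0` for all vectors `v`. -/
def MatNonneg {n : ℕ} (m : Matrix (Fin n) (Fin n) L) : Prop :=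
  ∀ v : Fin n → L, 0 ≤ ∑ i, ∑ j, star (v i) * m i j * v j

/-- The upper half-plane `H₊(Mₙ(S))` of matrices with entries in the subalgebra `S`:
matrices `β` with `Im β ≥ ε·1` for some `ε > 0`. -/
def matUpperHalfPlane {n : ℕ} (S : Subalgebra ℂ L) : Set (Matrix (Fin n) (Fin n) L) :=
  {β | (∀ i j, β i j ∈ S) ∧
    ∃ ε : ℝ, 0 < ε ∧ MatNonneg L (imPartM L β - (ε : ℂ) • (1 : Matrix (Fin n) (Fin n) L))}

/-- The projective tensor seminorm on `L ⊗ L`. -/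
noncomputable def projNorm [NormedRing L] (t : L ⊗[ℂ] L) : ℝ :=
  sInf {c | ∃ l : List (L × L), t = (l.map fun q => q.1 ⊗ₜ[ℂ] q.2).sum ∧
    c = (l.map fun q => ‖q.1‖ * ‖q.2‖).sum}

end


section absCstar
variable {R : Type*} [CStarAlgebra R] [PartialOrder R] [StarOrderedRing R]

theorem sub_im_ineq (T : R) (ε : ℝ) (hε : 0 < ε)
    (h : (ε : ℂ) • (1 : R) ≤ (2 * Complex.I)⁻¹ • (T - star T)) :
    ((ε ^ 2 : ℝ) : ℂ) • (1 : R) ≤ star T * T := by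
  set W : R := T - (Complex.I * ε) • (1 : R) with hW
  have h2 : 0 ≤ (2 * ε : ℝ) • ((2 * Complex.I)⁻¹ • (T - star T) - (ε : ℂ) • (1 : R)) :=
    smul_nonneg (by positivity) (sub_nonneg.2 h)
  have h3 : 0 ≤ star W * W := star_mul_self_nonneg W
  have e : star T * T - ((ε ^ 2 : ℝ) : ℂ) • (1 : R) = star W * W +
      (2 * ε : ℝ) • ((2 * Complex.I)⁻¹ • (T - star T) - (ε : ℂ) • (1 : R)) := by
    have hI : (Complex.I)⁻¹ = - Complex.I := Complex.inv_I
    rw [← Complex.coe_smul]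
    simp only [hW, star_sub, star_smul, star_one, sub_mul, mul_sub, smul_mul_assoc, one_mul,
      mul_smul_comm, mul_one, smul_sub, smul_smul, mul_inv, hI]
    simp only [Complex.star_def, map_mul, Complex.conj_I, Complex.conj_ofReal]
    have hI2 : Complex.I ^ 2 = -1 := Complex.I_sq
    match_scalars <;> push_cast <;> ring_nf <;> simp [hI2] <;> ring
  rw [← sub_nonneg, e]
  exact add_nonneg h3 h2

theorem sub_im_ineq' (T : R) (ε : ℝ) (hε : 0 < ε)
    (h : (ε : ℂ) • (1 : R) ≤ (2 * Complex.I)⁻¹ • (T - star T)) :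
    ((ε ^ 2 : ℝ) : ℂ) • (1 : R) ≤ T * star T := by
  have := sub_im_ineq (-star T) ε hε (by
    convert h using 2
    simp; abel)
  simpa using this

theorem isUnit_of_ge (P : R) (ε : ℝ) (hε : 0 < ε) (h : (ε : ℂ) • (1 : R) ≤ P) : IsUnit P := by
  refine CStarAlgebra.isUnit_of_le ((ε : ℂ) • (1 : R)) h ?_
  constructor
  · rw [Complex.coe_smul]
    exact smul_nonneg hε.le zero_le_one
  · rw [← Algebra.algebraMap_eq_smul_one]
    exact (IsUnit.mk0 (ε : ℂ) (by exact_mod_cast hε.ne')).map (algebraMap ℂ R)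

theorem isUnit_of_im (T : R) (ε : ℝ) (hε : 0 < ε)
    (h : (ε : ℂ) • (1 : R) ≤ (2 * Complex.I)⁻¹ • (T - star T)) : IsUnit T := by
  obtain ⟨u, hu⟩ := isUnit_of_ge _ _ (by positivity) (sub_im_ineq T ε hε h)
  obtain ⟨v, hv⟩ := isUnit_of_ge _ _ (by positivity) (sub_im_ineq' T ε hε h)
  rw [isUnit_iff_exists_and_exists]
  refine ⟨⟨star T * ↑v⁻¹, ?_⟩, ⟨↑u⁻¹ * star T, ?_⟩⟩
  · rw [← mul_assoc, ← hv]; simp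
  · rw [mul_assoc, ← hu]; simp

theorem im_inv (Z V : R) (hZV : Z * V = 1) (hVZ : V * Z = 1) (ε : ℝ) (hε : 0 < ε)
    (h : (ε : ℂ) • (1 : R) ≤ (2 * Complex.I)⁻¹ • (-Z - star (-Z))) :
    ∃ δ : ℝ, 0 < δ ∧ (δ : ℂ) • (1 : R) ≤ (2 * Complex.I)⁻¹ • (V - star V) := by
  have h1 : (ε : ℂ) • (V * star V) ≤ (2 * Complex.I)⁻¹ • (V - star V) := by
    have := star_right_conjugate_le_conjugate h V
    have hs : star Z * star V = 1 := by rw [← star_mul, hVZ, star_one]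
    convert this using 1
    · simp
    · simp only [mul_smul_comm, smul_mul_assoc, mul_sub, sub_mul, star_neg, mul_neg, neg_mul, hVZ]
      rw [mul_assoc V, hs]; simp only [mul_one, one_mul]; module
  -- V * star V ≥ δ
  have h2 : Z * star Z ≤ algebraMap ℝ R (‖Z‖ ^ 2) := CStarAlgebra.mul_star_le_algebraMap_norm_sq
  have h3 : Z * star Z ≤ ((‖Z‖ ^ 2 + 1 : ℝ)) • (1 : R) := by
    refine h2.trans ?_
    rw [Algebra.algebraMap_eq_smul_one]
    exact smul_le_smul_of_nonneg_right (by linarith) zero_le_one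
  have h4 := star_right_conjugate_le_conjugate h3 V
  have h5 : (1 : R) ≤ (‖Z‖ ^ 2 + 1) • (V * star V) := by
    convert h4 using 1
    · have hs : star Z * star V = 1 := by rw [← star_mul, hVZ, star_one]
      rw [← mul_assoc, hVZ, one_mul, hs]
    · simp
  refine ⟨ε * (‖Z‖ ^ 2 + 1)⁻¹, by positivity, le_trans ?_ h1⟩
  rw [Complex.coe_smul, Complex.coe_smul, mul_smul]
  refine smul_le_smul_of_nonneg_left ?_ hε.le
  rw [inv_smul_le_iff_of_pos (by positivity)]
  exact h5

theorem contraction_of_ge (P : R) (ε : ℝ) (hε : 0 < ε) (h : (ε : ℂ) • (1 : R) ≤ P) :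
    ∃ c : ℝ, 0 < c ∧ ‖(1 : R) - (c : ℂ) • P‖ < 1 := by
  have hP : 0 ≤ P := le_trans (by rw [Complex.coe_smul]; exact smul_nonneg hε.le zero_le_one) h
  set M : ℝ := ‖P‖ + ε with hM
  have hMpos : 0 < M := by positivity
  have h1 : P ≤ M • (1 : R) := by
    have := IsSelfAdjoint.le_algebraMap_norm_self (IsSelfAdjoint.of_nonneg hP)
    rw [Algebra.algebraMap_eq_smul_one] at this
    exact this.trans (smul_le_smul_of_nonneg_right (by linarith) zero_le_one)
  refine ⟨M⁻¹, by positivity, ?_⟩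
  rw [Complex.coe_smul]
  rw [Complex.coe_smul] at h
  have h2 : 0 ≤ (1 : R) - M⁻¹ • P := by
    rw [sub_nonneg, inv_smul_le_iff_of_pos hMpos]; exact h1
  have h3 : (1 : R) - M⁻¹ • P ≤ algebraMap ℝ R (1 - M⁻¹ * ε) := by
    rw [Algebra.algebraMap_eq_smul_one, sub_smul, one_smul, mul_smul]
    exact sub_le_sub_left (smul_le_smul_of_nonneg_left h (by positivity)) _
  have h4 : M⁻¹ * ε ≤ 1 := by
    rw [inv_mul_le_iff₀ hMpos]; linarith [norm_nonneg P]
  have h5 := (CStarAlgebra.norm_le_iff_le_algebraMap _ (by linarith) h2).2 h3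
  have : 0 < M⁻¹ * ε := by positivity
  linarith

end absCstar
section gen
variable {R : Type*} [CStarAlgebra R] [PartialOrder R] [StarOrderedRing R]
theorem gen_nonneg (r : R) (h : 0 ≤ r) : ∃ x, r = star x * x :=
  CStarAlgebra.nonneg_iff_eq_star_mul_self.1 h

theorem gen_selfAdj (r : R) (h : 0 ≤ r) : star r = r := (IsSelfAdjoint.of_nonneg h).star_eq

theorem gen_neg (m : R) (hs : star m = m) : ∃ p q x : R, 0 ≤ p ∧ p - q = m ∧
    star q * m * q = - (star x * x) ∧ (x = 0 → q = 0) := by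
  have h1 : m⁺ - m⁻ = m := CFC.posPart_sub_negPart m hs
  have h2 : m⁺ * m⁻ = 0 := CFC.posPart_mul_negPart m
  have h0 : 0 ≤ m⁻ := CFC.negPart_nonneg m
  have h0s : IsSelfAdjoint m⁻ := IsSelfAdjoint.of_nonneg h0
  have h3 : star m⁻ * m * m⁻ = - (m⁻ * m⁻ * m⁻) := by
    have key : m * m⁻ = (m⁺ - m⁻) * m⁻ := by rw [h1]
    rw [mul_assoc, key, sub_mul, h2, h0s.star_eq]; simp [mul_assoc]
  obtain ⟨x, hx⟩ := CStarAlgebra.nonneg_iff_eq_star_mul_self.1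
    (h0s.conjugate_nonneg h0)
  refine ⟨m⁺, m⁻, x, CFC.posPart_nonneg m, h1, by rw [h3, hx], ?_⟩
  intro hx0
  rw [hx0, mul_zero] at hx
  have a1 : (m⁻ * m⁻) * star (m⁻ * m⁻) = 0 := by
    rw [star_mul, h0s.star_eq, ← mul_assoc, hx, zero_mul]
  have a2 := (CStarRing.mul_star_self_eq_zero_iff _).1 a1
  have a3 : m⁻ * star m⁻ = 0 := by rw [h0s.star_eq, a2]
  exact (CStarRing.mul_star_self_eq_zero_iff _).1 a3
end gen

section matpos
variable {L : Type*} [CStarAlgebra L] [PartialOrder L] [StarOrderedRing L] {n : ℕ}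

theorem matNonneg_of_nonneg (m : CStarMatrix (Fin n) (Fin n) L) (h : 0 ≤ m) :
    MatNonneg L (CStarMatrix.ofMatrix.symm m) := by
  obtain ⟨x, rfl⟩ := gen_nonneg _ h
  intro v
  have : ∑ i, ∑ j, star (v i) * (star x * x) i j * v j =
      ∑ k, star (∑ i, x k i * v i) * (∑ j, x k j * v j) := by
    simp only [CStarMatrix.mul_apply, CStarMatrix.star_apply, star_sum, star_mul,
      Finset.mul_sum, Finset.sum_mul]
    have e : ∀ i j, (∑ k, star (v i) * (star (x k i) * x k j) * v j) =
      ∑ k, star (v i) * star (x k i) * (x k j * v j) := fun i j => by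
        simp only [mul_assoc]
    simp only [e]
    calc _ = ∑ i, ∑ k, ∑ j, star (v i) * star (x k i) * (x k j * v j) :=
          Finset.sum_congr rfl fun i _ => Finset.sum_comm
      _ = ∑ k, ∑ i, ∑ j, star (v i) * star (x k i) * (x k j * v j) := Finset.sum_comm
      _ = _ := Finset.sum_congr rfl fun i _ => Finset.sum_comm
  simp only [CStarMatrix.ofMatrix_symm_apply]
  rw [this]
  exact Finset.sum_nonneg fun k _ => star_mul_self_nonneg _

theorem nonneg_of_matNonneg (m : CStarMatrix (Fin n) (Fin n) L) (hs : star m = m)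
    (h : MatNonneg L (CStarMatrix.ofMatrix.symm m)) : 0 ≤ m := by
  obtain ⟨p, q, x, hp, h1, h3, hq⟩ := gen_neg m hs
  have h4 : ∀ k l, x l k = 0 := by
    intro k
    have h5 := h (fun i => q i k)
    have h6 : ∑ i, ∑ j, star (q i k) * m i j * q j k = (star q * m * q) k k := by
      simp only [CStarMatrix.mul_apply, CStarMatrix.star_apply, Finset.sum_mul]
      exact Finset.sum_comm
    simp only [CStarMatrix.ofMatrix_symm_apply] at h5
    rw [h6, h3] at h5
    have h7 : ∑ l, star (x l k) * x l k = (star x * x) k k := by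
      simp only [CStarMatrix.mul_apply, CStarMatrix.star_apply]
    rw [CStarMatrix.neg_apply, ← h7, Left.nonneg_neg_iff] at h5
    have h8 := le_antisymm h5 (Finset.sum_nonneg fun l _ => star_mul_self_nonneg (x l k))
    rw [Finset.sum_eq_zero_iff_of_nonneg (fun l _ => star_mul_self_nonneg (x l k))] at h8
    intro l
    exact CStarRing.star_mul_self_eq_zero_iff _ |>.1 (h8 l (Finset.mem_univ _))
  have hx0 : x = 0 := CStarMatrix.ext fun i j => h4 j i
  rw [hq hx0, sub_zero] at h1
  exact h1 ▸ hp

variable {K : Type*} [CStarAlgebra K] [PartialOrder K] [StarOrderedRing K]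

theorem map_nonneg_of_cp (Ψ : L →ₗ[ℂ] K) (hΨstar : ∀ x : L, Ψ (star x) = star (Ψ x))
    (hΨcp : ∀ (m : ℕ) (v : Fin m → L) (w : Fin m → K),
      0 ≤ ∑ i, ∑ j, star (w i) * Ψ (star (v i) * v j) * w j)
    (m : CStarMatrix (Fin n) (Fin n) L) (h : 0 ≤ m) : 0 ≤ m.map Ψ := by
  apply nonneg_of_matNonneg
  · ext i j
    have := gen_selfAdj m h
    rw [CStarMatrix.star_apply, CStarMatrix.map_apply, CStarMatrix.map_apply, ← hΨstar,
      ← CStarMatrix.star_apply, this]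
  · obtain ⟨x, rfl⟩ := gen_nonneg _ h
    intro w
    have : ∑ i, ∑ j, star (w i) * ((star x * x).map Ψ) i j * w j =
      ∑ k, ∑ i, ∑ j, star (w i) * Ψ (star (x k i) * x k j) * w j := by
      simp only [CStarMatrix.map_apply, CStarMatrix.mul_apply, CStarMatrix.star_apply, map_sum,
        Finset.mul_sum, Finset.sum_mul]
      calc _ = ∑ i, ∑ k, ∑ j, star (w i) * Ψ (star (x k i) * x k j) * w j :=
            Finset.sum_congr rfl fun i _ => Finset.sum_comm
        _ = _ := Finset.sum_comm
    simp only [CStarMatrix.ofMatrix_symm_apply]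
    rw [this]
    exact Finset.sum_nonneg fun k _ => hΨcp _ _ _

end matpos

section jordan
open scoped ComplexOrder ComplexStarModule
variable {K : Type*} [CStarAlgebra K] [PartialOrder K] [StarOrderedRing K]

theorem jordan_real (φ : K →L[ℂ] ℂ) : ∃ g : K →ₗ[ℝ] ℝ, ∀ b : K, 0 ≤ b →
    0 ≤ g b ∧ (φ b).re ≤ g b := by
  classical
  set C : ℝ := ‖φ‖ with hC
  have hC0 : 0 ≤ C := norm_nonneg _
  let S : K → Set ℝ := fun h => {r | ∃ b c : K, 0 ≤ b ∧ 0 ≤ c ∧ r = C * ‖h + b + c‖ - (φ b).re}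
  let p : K → ℝ := fun h => sInf (S h)
  have hbd : ∀ h : K, ∀ b c : K, 0 ≤ b → 0 ≤ c → -(C * ‖h‖) ≤ C * ‖h + b + c‖ - (φ b).re := by
    intro h b c hb hc
    have h1 : ‖b‖ ≤ ‖b + c‖ := CStarAlgebra.norm_le_norm_of_nonneg_of_le hb (le_add_of_nonneg_right hc)
    have h2 : (φ b).re ≤ C * ‖b‖ := (Complex.re_le_norm _).trans (φ.le_opNorm b)
    have h3 : ‖b + c‖ ≤ ‖h + b + c‖ + ‖h‖ := by
      have : b + c = (h + b + c) - h := by abel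
      rw [this]; exact norm_sub_le _ _
    have h4 : C * ‖b‖ ≤ C * (‖h + b + c‖ + ‖h‖) := mul_le_mul_of_nonneg_left (h1.trans h3) hC0
    linarith
  have hp_le : ∀ h b c : K, 0 ≤ b → 0 ≤ c → p h ≤ C * ‖h + b + c‖ - (φ b).re := by
    intro h b c hb hc
    refine csInf_le ⟨-(C * ‖h‖), ?_⟩ ⟨b, c, hb, hc, rfl⟩
    rintro r ⟨b, c, hb, hc, rfl⟩
    exact hbd h b c hb hc
  have hle_p : ∀ (h : K) (r : ℝ), (∀ b c : K, 0 ≤ b → 0 ≤ c → r ≤ C * ‖h + b + c‖ - (φ b).re) →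
      r ≤ p h := by
    intro h r H
    refine le_csInf ⟨_, 0, 0, le_rfl, le_rfl, rfl⟩ ?_
    rintro r ⟨b, c, hb, hc, rfl⟩
    exact H b c hb hc
  have hval : ∀ (t : ℝ), 0 < t → ∀ h b c : K, C * ‖t • h + t • b + t • c‖ - (φ (t • b)).re =
      t * (C * ‖h + b + c‖ - (φ b).re) := by
    intro t ht h b c
    have e2 : φ (t • b) = (t : ℂ) * φ b := by
      rw [← Complex.coe_smul, map_smul, smul_eq_mul]
    rw [← smul_add, ← smul_add, norm_smul, Real.norm_of_nonneg ht.le, e2, Complex.re_ofReal_mul]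
    ring
  have hhom1 : ∀ (t : ℝ), 0 < t → ∀ h, p (t • h) ≤ t * p h := by
    intro t ht h
    rw [← div_le_iff₀' ht]
    refine hle_p _ _ fun b c hb hc => ?_
    rw [div_le_iff₀' ht, ← hval t ht]
    exact hp_le _ _ _ (smul_nonneg ht.le hb) (smul_nonneg ht.le hc)
  have hhom : ∀ (t : ℝ), 0 < t → ∀ h, p (t • h) = t * p h := by
    intro t ht h
    refine le_antisymm (hhom1 t ht h) ?_
    have := hhom1 t⁻¹ (inv_pos.2 ht) (t • h)
    rw [inv_smul_smul₀ ht.ne', ← div_eq_inv_mul, le_div_iff₀' ht] at this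
    exact this
  have hadd : ∀ x y, p (x + y) ≤ p x + p y := by
    intro x y
    rw [← sub_le_iff_le_add]
    refine hle_p _ _ fun b c hb hc => ?_
    rw [sub_le_iff_le_add, ← sub_le_iff_le_add']
    refine hle_p _ _ fun b' c' hb' hc' => ?_
    have h1 := hp_le (x + y) (b + b') (c + c') (add_nonneg hb hb') (add_nonneg hc hc')
    have h2 : ‖x + y + (b + b') + (c + c')‖ ≤ ‖x + b + c‖ + ‖y + b' + c'‖ := by
      have : x + y + (b + b') + (c + c') = (x + b + c) + (y + b' + c') := by abel
      rw [this]; exact norm_add_le _ _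
    have h3 := mul_le_mul_of_nonneg_left h2 hC0
    rw [map_add, Complex.add_re] at h1
    linarith
  obtain ⟨g, -, hg⟩ := exists_extension_of_le_sublinear (⟨⊥, 0⟩ : K →ₗ.[ℝ] ℝ) p hhom hadd (by
    rintro ⟨x, hx⟩
    have hx' : x = 0 := by simpa using hx
    subst hx'
    refine hle_p _ _ fun b c hb hc => ?_
    simpa using hbd 0 b c hb hc)
  refine ⟨g, fun b hb => ⟨?_, ?_⟩⟩
  · have := (hg (-b)).trans (hp_le (-b) 0 b le_rfl hb)
    simpa using this
  · have := (hg (-b)).trans (hp_le (-b) b 0 hb le_rfl)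
    simpa using this

theorem jordan_cplx (φ : K →L[ℂ] ℂ) (hφ : ∀ y, φ (star y) = star (φ y)) :
    ∃ ψ₁ ψ₂ : K →ₚ[ℂ] ℂ, ∀ y, φ y = ψ₁ y - ψ₂ y := by
  obtain ⟨g, hg⟩ := jordan_real φ
  let ψ : K →ₗ[ℂ] ℂ :=
    { toFun := fun y => (g (ℜ y : K) : ℂ) + Complex.I * (g (ℑ y : K) : ℂ)
      map_add' := fun x y => by simp; ring
      map_smul' := fun c y => by
        simp [realPart_smul, imaginaryPart_smul]
        apply Complex.ext <;> simp }
  have hψ : ∀ b : K, 0 ≤ b → ψ b = (g b : ℂ) := by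
    intro b hb
    have hs := IsSelfAdjoint.of_nonneg hb
    simp [ψ, hs.coe_realPart, hs.imaginaryPart]
  refine ⟨PositiveLinearMap.mk₀ ψ fun b hb => ?_, PositiveLinearMap.mk₀ (ψ - (φ : K →ₗ[ℂ] ℂ)) fun b hb => ?_, fun y => ?_⟩
  · rw [hψ b hb]
    exact_mod_cast (hg b hb).1
  · have hs := IsSelfAdjoint.of_nonneg hb
    have : φ b = ((φ b).re : ℂ) := by
      have := hφ b
      rw [hs.star_eq] at this
      exact (Complex.conj_eq_iff_re.1 this.symm).symm
    rw [LinearMap.sub_apply, hψ b hb, ContinuousLinearMap.coe_coe, this, ← Complex.ofReal_sub]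
    exact_mod_cast sub_nonneg.2 (hg b hb).2
  · show φ y = ψ y - (ψ y - φ y)
    ring

theorem vec_functional (ψ₁ ψ₂ : K →ₚ[ℂ] ℂ) :
    ∃ (ω : K →ₚ[ℂ] ℂ) (ξ η : ω.GNS), ∀ y, ψ₁ y - ψ₂ y = inner ℂ η (ω.gnsStarAlgHom y ξ) := by
  let ω : K →ₚ[ℂ] ℂ := PositiveLinearMap.mk₀ (ψ₁.toLinearMap + ψ₂.toLinearMap) fun b hb =>
    add_nonneg (ψ₁.map_nonneg hb) (ψ₂.map_nonneg hb)
  have hω : ∀ y, ω y = ψ₁ y + ψ₂ y := fun y => rfl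
  have cs : ∀ (f : K →ₚ[ℂ] ℂ), (∀ b, 0 ≤ b → (f b).re ≤ (ω b).re) → ∀ y : K,
      ‖f y‖ ≤ ‖f.toPreGNS 1‖ * ‖ω.toPreGNS y‖ := by
    intro f hf y
    have h1 : f y = inner ℂ (f.toPreGNS 1) (f.toPreGNS y) := by
      rw [PositiveLinearMap.preGNS_inner_def]; simp
    rw [h1]
    refine (norm_inner_le_norm _ _).trans (mul_le_mul_of_nonneg_left ?_ (norm_nonneg _))
    rw [PositiveLinearMap.preGNS_norm_def, PositiveLinearMap.preGNS_norm_def]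
    exact Real.sqrt_le_sqrt (hf _ (star_mul_self_nonneg _))
  have h1 := cs ψ₁ fun b hb => by
    rw [hω, Complex.add_re]
    have := (Complex.nonneg_iff.1 (ψ₂.map_nonneg hb)).1
    linarith
  have h2 := cs ψ₂ fun b hb => by
    rw [hω, Complex.add_re]
    have := (Complex.nonneg_iff.1 (ψ₁.map_nonneg hb)).1
    linarith
  let Λ : ω.PreGNS →L[ℂ] ℂ := LinearMap.mkContinuous
    ((ψ₁.toLinearMap - ψ₂.toLinearMap) ∘ₗ ω.ofPreGNS.toLinearMap)
    (‖ψ₁.toPreGNS 1‖ + ‖ψ₂.toPreGNS 1‖) (fun y => by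
      have a := h1 (ω.ofPreGNS y)
      have b := h2 (ω.ofPreGNS y)
      rw [PositiveLinearMap.toPreGNS_ofPreGNS] at a b
      rw [add_mul]
      exact (norm_sub_le _ _).trans (add_le_add a b))
  let Λ' : ω.GNS →L[ℂ] ℂ := Λ.extend UniformSpace.Completion.toComplL
  refine ⟨ω, (ω.toPreGNS 1 : ω.PreGNS), (InnerProductSpace.toDual ℂ ω.GNS).symm Λ', fun y => ?_⟩
  rw [InnerProductSpace.toDual_symm_apply]
  have h3 : ω.gnsStarAlgHom y ((ω.toPreGNS 1 : ω.PreGNS) : ω.GNS) = ((ω.toPreGNS y : ω.PreGNS) : ω.GNS) := by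
    simp
  rw [h3]
  have h4 := ContinuousLinearMap.extend_eq Λ (e := UniformSpace.Completion.toComplL (𝕜 := ℂ) (E := ω.PreGNS))
    UniformSpace.Completion.denseRange_coe (UniformSpace.Completion.isUniformInducing_coe _) (ω.toPreGNS y)
  exact h4.symm

theorem sep_closed (A : Subalgebra ℂ K) (hAclosed : IsClosed (A : Set K)) (x : K) (hxA : x ∉ A) :
    ∃ φ : K →L[ℂ] ℂ, φ x ≠ 0 ∧ ∀ a ∈ A, φ a = 0 := by
  obtain ⟨f, u, hf1, hf2⟩ := RCLike.geometric_hahn_banach_closed_point (𝕜 := ℂ) (s := (A : Set K))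
    (x := x) (A.toSubmodule.restrictScalars ℝ).convex hAclosed hxA
  have h0 : ∀ a ∈ A, f a = 0 := by
    intro a ha
    by_contra hne
    have hpos : 0 < Complex.normSq (f a) := Complex.normSq_pos.2 hne
    have := hf1 (((u / Complex.normSq (f a) : ℝ) * (starRingEnd ℂ) (f a)) • a)
      (A.smul_mem ha _)
    rw [map_smul, smul_eq_mul, mul_assoc, ← Complex.normSq_eq_conj_mul_self,
      ← Complex.ofReal_mul, div_mul_cancel₀ _ hpos.ne'] at this
    simp at this
  refine ⟨f, fun hx => ?_, h0⟩
  have h1 := hf1 0 A.zero_mem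
  rw [hx] at hf2
  rw [map_zero] at h1
  exact lt_asymm h1 hf2

theorem mem_of_commutant (A : Subalgebra ℂ K) (hAclosed : IsClosed (A : Set K))
    (hAstar : ∀ a ∈ A, star a ∈ A) (x : K)
    (hx : ∀ (ω : K →ₚ[ℂ] ℂ) (T : ω.GNS →L[ℂ] ω.GNS), (∀ a ∈ A, Commute (ω.gnsStarAlgHom a) T) →
      Commute (ω.gnsStarAlgHom x) T) : x ∈ A := by
  have key : ∀ φ : K →L[ℂ] ℂ, (∀ y, φ (star y) = star (φ y)) → (∀ a ∈ A, φ a = 0) → φ x = 0 := by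
    intro φ hφ hφA
    obtain ⟨ψ₁, ψ₂, h12⟩ := jordan_cplx φ hφ
    obtain ⟨ω, ξ, η, hv⟩ := vec_functional ψ₁ ψ₂
    let V₀ : Submodule ℂ ω.GNS := (A.toSubmodule).map
      ((LinearMap.applyₗ η ∘ₗ ContinuousLinearMap.coeLM ℂ) ∘ₗ ω.gnsStarAlgHom.toAlgHom.toLinearMap)
    have hV₀ : ∀ v, v ∈ V₀ ↔ ∃ a ∈ A, ω.gnsStarAlgHom a η = v := by
      intro v; rfl
    let V := V₀.topologicalClosure
    have : CompleteSpace V := V₀.isClosed_topologicalClosure.completeSpace_coe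
    have hinv : ∀ a ∈ A, ∀ v ∈ V, ω.gnsStarAlgHom a v ∈ V := by
      intro a ha v hvV
      refine map_mem_closure (ω.gnsStarAlgHom a).continuous hvV ?_
      intro w hw
      obtain ⟨b, hb, rfl⟩ := (hV₀ w).1 hw
      exact (hV₀ _).2 ⟨a * b, A.mul_mem ha hb, by simp⟩
    have hadj : ∀ (a : K) (u v : ω.GNS), inner ℂ (ω.gnsStarAlgHom a u) v =
        inner ℂ u (ω.gnsStarAlgHom (star a) v) := by
      intro a u v
      rw [map_star, ContinuousLinearMap.star_eq_adjoint, ContinuousLinearMap.adjoint_inner_right]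
    have hinv' : ∀ a ∈ A, ∀ v ∈ Vᗮ, ω.gnsStarAlgHom a v ∈ Vᗮ := by
      intro a ha v hvV
      rw [Submodule.mem_orthogonal'] at hvV ⊢
      intro u hu
      rw [hadj]
      exact hvV _ (hinv _ (hAstar a ha) _ hu)
    have hcomm : ∀ a ∈ A, Commute (ω.gnsStarAlgHom a) V.starProjection := by
      intro a ha
      refine ContinuousLinearMap.ext fun v => ?_
      show ω.gnsStarAlgHom a (V.starProjection v) = V.starProjection (ω.gnsStarAlgHom a v)
      refine (Submodule.eq_starProjection_of_mem_orthogonal (hinv a ha _ (Submodule.starProjection_apply_mem _ _)) ?_).symm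
      rw [← map_sub]
      exact hinv' a ha _ (Submodule.sub_starProjection_mem_orthogonal _)
    have hη : η ∈ V := V₀.le_topologicalClosure ((hV₀ _).2 ⟨1, A.one_mem, by simp⟩)
    have hξ : ξ ∈ Vᗮ := by
      have : ξ ∈ V₀ᗮ := by
        rw [Submodule.mem_orthogonal]
        intro u hu
        obtain ⟨a, ha, rfl⟩ := (hV₀ u).1 hu
        rw [hadj, ← hv, ← h12]
        exact hφA _ (hAstar a ha)
      rwa [← Submodule.orthogonal_closure] at this
    have hc := hx ω _ hcomm
    have hc2 := congrArg (fun S : ω.GNS →L[ℂ] ω.GNS => S ξ) hc.eq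
    have hc3 : ω.gnsStarAlgHom x (V.starProjection ξ) = V.starProjection (ω.gnsStarAlgHom x ξ) := hc2
    rw [h12, hv]
    have e1 : V.starProjection ξ = 0 := by
      rw [Submodule.starProjection_apply_eq_zero_iff]; exact hξ
    have e2 : V.starProjection η = η := Submodule.starProjection_eq_self_iff.2 hη
    rw [← e2, Submodule.inner_starProjection_left_eq_right, ← hc3, e1]
    simp
  by_contra hxA
  obtain ⟨φ, hφ1, hφ2⟩ : ∃ φ : K →L[ℂ] ℂ, φ x ≠ 0 ∧ ∀ a ∈ A, φ a = 0 := sep_closed A hAclosed x hxA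
  let φs : K →L[ℂ] ℂ := ⟨{ toFun := fun y => star (φ (star y))
                           map_add' := by simp
                           map_smul' := by simp }, by
                             show Continuous fun y => star (φ (star y))
                             fun_prop⟩
  have hφs : ∀ y, φs y = star (φ (star y)) := fun y => rfl
  have k1 := key (φ + φs) (fun y => by
    simp only [add_apply, hφs, star_star, star_add]; rw [add_comm]) (fun a ha => by
    simp [hφs, hφ2 a ha, hφ2 _ (hAstar a ha)])
  have k2 := key (Complex.I • (φ - φs)) (fun y => by
    simp only [smul_apply, sub_apply, hφs, star_star,
      Complex.star_def, map_sub, map_mul, Complex.conj_I, Complex.conj_conj, smul_eq_mul]; ring) (fun a ha => by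
    simp [hφs, hφ2 a ha, hφ2 _ (hAstar a ha)])
  apply hφ1
  have k3 : φ x + φs x = 0 := k1
  have k4 : φ x - φs x = 0 := by
    have : Complex.I * (φ x - φs x) = 0 := k2
    exact (mul_eq_zero.1 this).resolve_left Complex.I_ne_zero
  linear_combination (k3 + k4) / 2
end jordan

theorem limit_abs {R E : Type*} [NormedRing R] [SeminormedAddCommGroup E] (S : R → Prop)
    (hSm : ∀ y z, S y → S z → S (y * z))
    (δ : R → R → R → E)
    (hder : ∀ y z, S y → S z → ∀ s t, δ (y * z) s t = δ z (s * y) t + δ y s (z * t))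
    (hbd : ∀ y, ∃ C : ℝ, 0 ≤ C ∧ ∀ s t, ‖δ y s t‖ ≤ C * ‖s‖ * ‖t‖)
    (N : R) (hN : S N) (hN1 : ‖N‖ < 1) (s t : R) :
    Tendsto (fun k : ℕ => δ (N ^ k) s t) atTop (𝓝 0) := by
  obtain ⟨C, hC0, hC⟩ := hbd N
  have hS : ∀ k : ℕ, S (N ^ (k + 1)) := by
    intro k
    induction k with
    | zero => simpa using hN
    | succ k ih => rw [pow_succ']; exact hSm _ _ hN ih
  have key : ∀ (k : ℕ) (s t : R), ‖δ (N ^ (k + 1)) s t‖ ≤ (k + 1) * C * ‖N‖ ^ k * ‖s‖ * ‖t‖ := by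
    intro k
    induction k with
    | zero => intro s t; simpa using hC s t
    | succ k ih =>
      intro s t
      rw [pow_succ' N, hder _ _ hN (hS k)]
      have h1 := ih (s * N) t
      have h2 := hC s (N ^ (k + 1) * t)
      have h3 : ‖s * N‖ ≤ ‖s‖ * ‖N‖ := norm_mul_le _ _
      have h4 : ‖N ^ (k + 1) * t‖ ≤ ‖N‖ ^ (k + 1) * ‖t‖ :=
        (norm_mul_le _ _).trans (mul_le_mul_of_nonneg_right (norm_pow_le' N (Nat.succ_pos k)) (norm_nonneg _))
      calc _ ≤ _ := norm_add_le _ _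
        _ ≤ (k + 1) * C * ‖N‖ ^ k * (‖s‖ * ‖N‖) * ‖t‖ + C * ‖s‖ * (‖N‖ ^ (k + 1) * ‖t‖) := by
          refine add_le_add (h1.trans ?_) (h2.trans ?_) <;> gcongr
        _ = _ := by push_cast; ring
  rw [← tendsto_add_atTop_iff_nat 1]
  refine squeeze_zero_norm (fun k => key k s t) ?_
  have h1 := tendsto_self_mul_const_pow_of_lt_one (norm_nonneg N) hN1
  have h2 := tendsto_pow_atTop_nhds_zero_of_lt_one (norm_nonneg N) hN1
  have h3 := ((h1.add h2).mul_const (C * ‖s‖ * ‖t‖))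
  simp only [add_zero, zero_mul] at h3
  refine h3.congr fun k => ?_
  ring

section tens
variable {K L O : Type*} [Ring K] [Algebra ℂ K] [Ring L] [Algebra ℂ L] [Ring O] [Algebra ℂ O]

/-- sandwich map -/
noncomputable def sandw (p : K →ₗ[ℂ] O) (S : O) : K ⊗[ℂ] K →ₗ[ℂ] O :=
  TensorProduct.lift ((LinearMap.mul ℂ O).compl₁₂ (LinearMap.mulRight ℂ S ∘ₗ p) p)

theorem sandw_tmul (p : K →ₗ[ℂ] O) (S : O) (u v : K) :
    sandw p S (u ⊗ₜ v) = p u * S * p v := by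
  simp [sandw]

theorem comm_eq_sandw (π : K →ₐ[ℂ] O) (T : O) (A : Subalgebra ℂ K) (X : K)
    (AX : Subalgebra ℂ K) (hAX : AX = Algebra.adjoin ℂ ((A : Set K) ∪ {X}))
    (DX : K →ₗ[ℂ] K ⊗[ℂ] K)
    (hDXder : ∀ x ∈ AX, ∀ y ∈ AX, DX (x * y) =
      LinearMap.rTensor K (LinearMap.mulLeft ℂ x) (DX y) +
      LinearMap.lTensor K (LinearMap.mulRight ℂ y) (DX x))
    (hDXA : ∀ a ∈ A, DX a = 0)
    (hDXX : DX X = (1 : K) ⊗ₜ[ℂ] (1 : K))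
    (hT : ∀ a ∈ A, Commute (π a) T) (x : K) (hx : x ∈ AX) :
    π x * T - T * π x = sandw π.toLinearMap (π X * T - T * π X) (DX x) := by
  set S := π X * T - T * π X with hS
  have l1 : ∀ (u : K) (t : K ⊗[ℂ] K), sandw π.toLinearMap S
      (LinearMap.rTensor K (LinearMap.mulLeft ℂ u) t) = π u * sandw π.toLinearMap S t := by
    intro u t
    induction t using TensorProduct.induction_on with
    | zero => simp
    | tmul a b => simp [sandw_tmul, mul_assoc]
    | add a b ha hb => rw [map_add, map_add, ha, hb, map_add, mul_add]
  have l2 : ∀ (u : K) (t : K ⊗[ℂ] K), sandw π.toLinearMap S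
      (LinearMap.lTensor K (LinearMap.mulRight ℂ u) t) = sandw π.toLinearMap S t * π u := by
    intro u t
    induction t using TensorProduct.induction_on with
    | zero => simp
    | tmul a b => simp [sandw_tmul, mul_assoc]
    | add a b ha hb => rw [map_add, map_add, ha, hb, map_add, add_mul]
  have hA0 : ∀ a ∈ A, π a * T - T * π a = sandw π.toLinearMap S (DX a) := by
    intro a ha
    rw [hDXA a ha, map_zero, (hT a ha).eq, sub_self]
  subst hAX
  induction hx using Algebra.adjoin_induction with
  | mem x hx =>
    rcases hx with hx | hx
    · exact hA0 x hx
    · rw [Set.mem_singleton_iff.1 hx, hDXX, sandw_tmul]; simp [hS]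
  | algebraMap r => exact hA0 _ (A.algebraMap_mem r)
  | add x y hx hy ihx ihy => rw [map_add, map_add, map_add, ← ihx, ← ihy]; noncomm_ring
  | mul x y hx hy ihx ihy =>
    rw [hDXder x hx y hy, map_add, l1, l2, ← ihx, ← ihy, map_mul]; noncomm_ring

/-- the trilinear expression -/
noncomputable def triG (p : L →ₗ[ℂ] O) (S : O) (s : L) (e : L ⊗[ℂ] L) (t : L) : O :=
  sandw p S (TensorProduct.map (LinearMap.mulLeft ℂ s) (LinearMap.mulRight ℂ t) e)

theorem triG_tmul (p : L →ₗ[ℂ] O) (S : O) (s u v t : L) :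
    triG p S s (u ⊗ₜ v) t = p (s * u) * S * p (v * t) := by
  simp [triG, sandw_tmul]

theorem triG_add (p : L →ₗ[ℂ] O) (S : O) (s t : L) (e f : L ⊗[ℂ] L) :
    triG p S s (e + f) t = triG p S s e t + triG p S s f t := by
  simp [triG]

theorem triG_zero (p : L →ₗ[ℂ] O) (S : O) (s t : L) :
    triG p S s 0 t = 0 := by
  simp [triG]

theorem triG_one (p : L →ₗ[ℂ] O) (S : O) (e : L ⊗[ℂ] L) :
    triG p S 1 e 1 = sandw p S e := by
  simp [triG]

theorem triG_left (p : L →ₗ[ℂ] O) (S : O) (s t y : L) (e : L ⊗[ℂ] L) :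
    triG p S s (LinearMap.rTensor L (LinearMap.mulLeft ℂ y) e) t = triG p S (s * y) e t := by
  induction e using TensorProduct.induction_on with
  | zero => simp [triG]
  | tmul a b => simp [triG_tmul, mul_assoc]
  | add a b ha hb => rw [map_add, triG_add, triG_add, ha, hb]

theorem triG_right (p : L →ₗ[ℂ] O) (S : O) (s t y : L) (e : L ⊗[ℂ] L) :
    triG p S s (LinearMap.lTensor L (LinearMap.mulRight ℂ y) e) t = triG p S s e (y * t) := by
  induction e using TensorProduct.induction_on with
  | zero => simp [triG]
  | tmul a b => simp [triG_tmul, mul_assoc]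
  | add a b ha hb => rw [map_add, triG_add, triG_add, ha, hb]

theorem triG_ladd (p : L →ₗ[ℂ] O) (S : O) (s s' t : L) (e : L ⊗[ℂ] L) :
    triG p S (s + s') e t = triG p S s e t + triG p S s' e t := by
  induction e using TensorProduct.induction_on with
  | zero => simp [triG]
  | tmul a b => simp [triG_tmul, add_mul]
  | add a b ha hb => rw [triG_add, triG_add, triG_add, ha, hb]; abel

theorem triG_radd (p : L →ₗ[ℂ] O) (S : O) (s t t' : L) (e : L ⊗[ℂ] L) :
    triG p S s e (t + t') = triG p S s e t + triG p S s e t' := by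
  induction e using TensorProduct.induction_on with
  | zero => simp [triG]
  | tmul a b => simp [triG_tmul, mul_add]
  | add a b ha hb => rw [triG_add, triG_add, triG_add, ha, hb]; abel

theorem triG_l0 (p : L →ₗ[ℂ] O) (S : O) (t : L) (e : L ⊗[ℂ] L) : triG p S 0 e t = 0 := by
  have := triG_ladd p S 0 0 t e
  simpa using this

theorem triG_r0 (p : L →ₗ[ℂ] O) (S : O) (t : L) (e : L ⊗[ℂ] L) : triG p S t e 0 = 0 := by
  have := triG_radd p S t 0 0 e
  simpa using this

theorem triG_lsum {ι : Type*} (p : L →ₗ[ℂ] O) (S : O) (t : L) (e : L ⊗[ℂ] L) (f : ι → L)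
    (F : Finset ι) : triG p S (∑ i ∈ F, f i) e t = ∑ i ∈ F, triG p S (f i) e t :=
  map_sum (⟨⟨fun s => triG p S s e t, triG_l0 p S t e⟩, fun s s' => triG_ladd p S s s' t e⟩ : L →+ O) f F

theorem triG_rsum {ι : Type*} (p : L →ₗ[ℂ] O) (S : O) (t : L) (e : L ⊗[ℂ] L) (f : ι → L)
    (F : Finset ι) : triG p S t e (∑ i ∈ F, f i) = ∑ i ∈ F, triG p S t e (f i) :=
  map_sum (⟨⟨fun s => triG p S t e s, triG_r0 p S t e⟩, fun s s' => triG_radd p S t s s' e⟩ : L →+ O) f F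

theorem triG_msum {ι : Type*} (p : L →ₗ[ℂ] O) (S : O) (s t : L) (f : ι → L ⊗[ℂ] L)
    (F : Finset ι) : triG p S s (∑ i ∈ F, f i) t = ∑ i ∈ F, triG p S s (f i) t :=
  map_sum (⟨⟨fun e => triG p S s e t, triG_zero p S s t⟩, fun e f => triG_add p S s t e f⟩ : L ⊗[ℂ] L →+ O) f F

end tens

theorem triG_bound {L O : Type*} [NormedRing L] [NormedAlgebra ℂ L] [NormedRing O] [NormedAlgebra ℂ O]
    (p : L →ₗ[ℂ] O) (S : O) (C : ℝ) (hC : 0 ≤ C) (hp : ∀ y, ‖p y‖ ≤ C * ‖y‖) (e : L ⊗[ℂ] L) :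
    ∃ M : ℝ, 0 ≤ M ∧ ∀ s t, ‖triG p S s e t‖ ≤ M * ‖s‖ * ‖t‖ := by
  induction e using TensorProduct.induction_on with
  | zero => exact ⟨0, le_rfl, fun s t => by simp [triG_zero]⟩
  | tmul a b =>
    refine ⟨C * ‖a‖ * ‖S‖ * (C * ‖b‖), by positivity, fun s t => ?_⟩
    rw [triG_tmul]
    have h1 : ‖p (s * a)‖ ≤ C * (‖s‖ * ‖a‖) :=
      (hp _).trans (mul_le_mul_of_nonneg_left (norm_mul_le _ _) hC)
    have h2 : ‖p (b * t)‖ ≤ C * (‖b‖ * ‖t‖) :=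
      (hp _).trans (mul_le_mul_of_nonneg_left (norm_mul_le _ _) hC)
    calc _ ≤ ‖p (s * a)‖ * ‖S‖ * ‖p (b * t)‖ :=
          (norm_mul_le _ _).trans (mul_le_mul_of_nonneg_right (norm_mul_le _ _) (norm_nonneg _))
      _ ≤ C * (‖s‖ * ‖a‖) * ‖S‖ * (C * (‖b‖ * ‖t‖)) := by gcongr
      _ = _ := by ring
  | add e f he hf =>
    obtain ⟨M, hM, h⟩ := he
    obtain ⟨M', hM', h'⟩ := hf
    refine ⟨M + M', by positivity, fun s t => ?_⟩
    rw [triG_add]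
    refine (norm_add_le _ _).trans ((add_le_add (h s t) (h' s t)).trans (le_of_eq ?_))
    ring

theorem limit_res {R E : Type*} [NormedRing R] [SeminormedAddCommGroup E] (S : Subring R)
    (δ : R → R → R → E)
    (hadd : ∀ y z s t, δ (y + z) s t = δ y s t + δ z s t)
    (hder : ∀ y z, y ∈ S → z ∈ S → ∀ s t, δ (y * z) s t = δ z (s * y) t + δ y s (z * t))
    (hbd : ∀ y, ∃ C : ℝ, 0 ≤ C ∧ ∀ s t, ‖δ y s t‖ ≤ C * ‖s‖ * ‖t‖)
    (Z W V : R) (hZ : Z ∈ S) (hW : W ∈ S) (hVZ : V * Z = 1)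
    (hN1 : ‖1 - Z * W‖ < 1) :
    ∃ r : ℕ → R, (∀ k, r k ∈ S) ∧ Tendsto r atTop (𝓝 V) ∧
      Tendsto (fun k => δ (r k) 1 1 + δ Z V (r k)) atTop (𝓝 0) := by
  set N := 1 - Z * W with hNdef
  have hN : N ∈ S := S.sub_mem S.one_mem (S.mul_mem hZ hW)
  have hr : ∀ k : ℕ, Z * (W * ∑ i ∈ Finset.range k, N ^ i) = 1 - N ^ k := by
    intro k
    rw [← mul_assoc, show Z * W = 1 - N by rw [hNdef]; abel]
    exact mul_neg_geom_sum N k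
  have hrS : ∀ k : ℕ, W * ∑ i ∈ Finset.range k, N ^ i ∈ S := fun k =>
    S.mul_mem hW (S.sum_mem fun i _ => S.pow_mem hN i)
  refine ⟨fun k => W * ∑ i ∈ Finset.range k, N ^ i, hrS, ?_, ?_⟩
  · have h1 : ∀ k : ℕ, W * ∑ i ∈ Finset.range k, N ^ i = V * (1 - N ^ k) := by
      intro k
      rw [← hr k, ← mul_assoc V, hVZ, one_mul]
    simp only [h1]
    have h2 := (tendsto_const_nhds (x := (1 : R))).sub (tendsto_pow_atTop_nhds_zero_of_norm_lt_one hN1)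
    simpa using h2.const_mul V
  · have h1 := limit_abs (fun y => y ∈ S) (fun y z hy hz => S.mul_mem hy hz) δ hder hbd N hN hN1 V 1
    have h0 : ∀ s t, δ 1 s t = 0 := by
      intro s t
      have := hder 1 1 S.one_mem S.one_mem s t
      simpa using this
    have h2 := h1.neg
    rw [neg_zero] at h2
    refine h2.congr fun k => ?_
    have h3 := hder Z _ hZ (hrS k) V 1
    rw [hr k, hVZ, mul_one] at h3
    have h4 := hadd (1 - N ^ k) (N ^ k) V 1
    rw [sub_add_cancel, h0] at h4
    rw [← h3]
    exact neg_eq_of_add_eq_zero_left h4.symm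

theorem sandw_map {K L O : Type*} [Ring K] [Algebra ℂ K] [Ring L] [Algebra ℂ L] [Ring O] [Algebra ℂ O]
    (q : K →ₗ[ℂ] O) (Ψ : L →ₗ[ℂ] K) (S : O) (e : L ⊗[ℂ] L) :
    sandw q S (TensorProduct.map Ψ Ψ e) = sandw (q ∘ₗ Ψ) S e := by
  induction e using TensorProduct.induction_on with
  | zero => simp
  | tmul a b => simp [sandw_tmul]
  | add a b ha hb => rw [map_add, map_add, ha, hb, map_add]

theorem core_comm {L O : Type*} [CStarAlgebra L] [PartialOrder L] [StarOrderedRing L]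
    [NormedRing O] [NormedAlgebra ℂ O] {n : ℕ}
    (p : L →ₗ[ℂ] O) (C : ℝ) (hC : 0 ≤ C) (hp : ∀ y, ‖p y‖ ≤ C * ‖y‖) (T S₀ : O)
    (BY : Subalgebra ℂ L) (DY : L →ₗ[ℂ] L ⊗[ℂ] L)
    (hDYder : ∀ x ∈ BY, ∀ y ∈ BY, DY (x * y) =
      LinearMap.rTensor L (LinearMap.mulLeft ℂ x) (DY y) +
      LinearMap.lTensor L (LinearMap.mulRight ℂ y) (DY x))
    (hcomm : ∀ y ∈ BY, p y * T - T * p y = sandw p S₀ (DY y))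
    (Z W V : CStarMatrix (Fin n) (Fin n) L)
    (hZ : ∀ i j, Z i j ∈ BY) (hW : ∀ i j, W i j ∈ BY)
    (hDZ : ∀ i j, DY (Z i j) = if i = j then (1 : L) ⊗ₜ[ℂ] (1 : L) else 0)
    (hVZ : V * Z = 1) (hN : ‖1 - Z * W‖ < 1) (i l : Fin n) :
    ∑ j, p (V i j) * S₀ * p (V j l) + (p (V i l) * T - T * p (V i l)) = 0 := by
  let S : Subring (CStarMatrix (Fin n) (Fin n) L) :=
    { carrier := {m | ∀ i j, m i j ∈ BY}
      mul_mem' := fun {a b} ha hb i j => by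
        rw [CStarMatrix.mul_apply]
        exact BY.sum_mem fun k _ => BY.mul_mem (ha i k) (hb k j)
      one_mem' := fun i j => by
        rw [CStarMatrix.one_apply]; split_ifs
        · exact BY.one_mem
        · exact BY.zero_mem
      add_mem' := fun {a b} ha hb i j => BY.add_mem (ha i j) (hb i j)
      zero_mem' := fun i j => BY.zero_mem
      neg_mem' := fun {a} ha i j => BY.neg_mem (ha i j) }
  let δ : CStarMatrix (Fin n) (Fin n) L → CStarMatrix (Fin n) (Fin n) L →
      CStarMatrix (Fin n) (Fin n) L → O := fun y s t =>
    ∑ j, ∑ k, triG p S₀ (s i j) (DY (y j k)) (t k l)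
  have hpc : Continuous p := p.mkContinuous C hp |>.continuous
  have hent : ∀ (j k : Fin n), Continuous fun m : CStarMatrix (Fin n) (Fin n) L => m j k := by
    intro j k
    exact (continuous_apply k).comp ((continuous_apply j).comp (CStarMatrix.ofMatrixL (m := Fin n) (n := Fin n) (A := L)).symm.continuous)
  have hadd : ∀ y z s t, δ (y + z) s t = δ y s t + δ z s t := by
    intro y z s t
    simp only [δ, CStarMatrix.add_apply, map_add, triG_add, Finset.sum_add_distrib]
  have hder : ∀ y z, y ∈ S → z ∈ S → ∀ s t, δ (y * z) s t = δ z (s * y) t + δ y s (z * t) := by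
    intro y z hy hz s t
    have : ∀ j k, DY ((y * z) j k) = 
        ∑ m, (LinearMap.rTensor L (LinearMap.mulLeft ℂ (y j m)) (DY (z m k)) +
          LinearMap.lTensor L (LinearMap.mulRight ℂ (z m k)) (DY (y j m))) := by
      intro j k
      rw [CStarMatrix.mul_apply, map_sum]
      exact Finset.sum_congr rfl fun m _ => hDYder _ (hy j m) _ (hz m k)
    simp only [δ, this, triG_msum, triG_add, triG_left, triG_right, Finset.sum_add_distrib]
    simp only [CStarMatrix.mul_apply, triG_lsum, triG_rsum]
    congr 1
    · rw [Finset.sum_comm]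
      conv_rhs => rw [Finset.sum_comm]
      refine Finset.sum_congr rfl fun k _ => ?_
      rw [Finset.sum_comm]
    · refine Finset.sum_congr rfl fun j _ => ?_
      rw [Finset.sum_comm]
  have hbd : ∀ y, ∃ C : ℝ, 0 ≤ C ∧ ∀ s t, ‖δ y s t‖ ≤ C * ‖s‖ * ‖t‖ := by
    intro y
    choose M hM hM' using fun e => triG_bound p S₀ C hC hp e
    refine ⟨∑ j, ∑ k, M (DY (y j k)), Finset.sum_nonneg fun j _ => Finset.sum_nonneg fun k _ => hM _, ?_⟩
    intro s t
    simp only [δ]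
    rw [Finset.sum_mul, Finset.sum_mul]
    refine (norm_sum_le _ _).trans (Finset.sum_le_sum fun j _ => ?_)
    rw [Finset.sum_mul, Finset.sum_mul]
    refine (norm_sum_le _ _).trans (Finset.sum_le_sum fun k _ => ?_)
    refine (hM' _ _ _).trans ?_
    have h1 := CStarMatrix.norm_entry_le_norm (M := s) (i := i) (j := j)
    have h2 := CStarMatrix.norm_entry_le_norm (M := t) (i := k) (j := l)
    have := hM (DY (y j k))
    gcongr
  obtain ⟨r, hrS, hr, hlim⟩ := limit_res S δ hadd hder hbd Z W V hZ hW hVZ hN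
  have e1 : ∀ k, δ (r k) 1 1 = p (r k i l) * T - T * p (r k i l) := by
    intro k
    rw [hcomm _ (hrS k i l)]
    simp only [δ, CStarMatrix.one_apply]
    rw [Finset.sum_eq_single i, Finset.sum_eq_single l]
    · simp [triG_one]
    · intro b _ hb; rw [if_neg hb, triG_r0]
    · simp
    · intro b _ hb; simp only [if_neg hb.symm, triG_l0, Finset.sum_const_zero]
    · simp
  have e2 : ∀ m, δ Z V m = ∑ j, p (V i j) * S₀ * p (m j l) := by
    intro m
    simp only [δ]
    refine Finset.sum_congr rfl fun j _ => ?_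
    rw [Finset.sum_eq_single j]
    · rw [hDZ, if_pos rfl, triG_tmul, mul_one, one_mul]
    · intro b _ hb; rw [hDZ, if_neg hb.symm, triG_zero]
    · simp
  simp only [e1, e2] at hlim
  have hlim2 : Tendsto (fun k => p (r k i l) * T - T * p (r k i l) +
      ∑ j, p (V i j) * S₀ * p (r k j l)) atTop
      (𝓝 (p (V i l) * T - T * p (V i l) + ∑ j, p (V i j) * S₀ * p (V j l))) := by
    have hc : Continuous fun m : CStarMatrix (Fin n) (Fin n) L => 
        p (m i l) * T - T * p (m i l) + ∑ j, p (V i j) * S₀ * p (m j l) := by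
      have := fun j k => hpc.comp (hent j k)
      simp only [Function.comp_def] at this
      fun_prop
    exact (hc.tendsto V).comp hr
  rw [add_comm]
  exact tendsto_nhds_unique hlim2 hlim

theorem comm_entries {O : Type*} [Ring O] {n : ℕ} (P Q : Matrix (Fin n) (Fin n) O)
    (hPQ : P * Q = 1) (hQP : Q * P = 1) (x T : O)
    (h : ∀ i l, ∑ j, P i j * (x * T - T * x) * P j l + (P i l * T - T * P i l) = 0)
    (i j : Fin n) : Commute ((Matrix.diagonal (fun _ => x) - Q : Matrix (Fin n) (Fin n) O) i j) T := by
  set χ : Matrix (Fin n) (Fin n) O := Matrix.diagonal (fun _ => x) with hχ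
  set τ : Matrix (Fin n) (Fin n) O := Matrix.diagonal (fun _ => T) with hτ
  have h1 : P * (χ * τ - τ * χ) * P + (P * τ - τ * P) = 0 := by
    ext i l
    have h2 : χ * τ - τ * χ = Matrix.diagonal (fun _ => x * T - T * x) := by
      rw [hχ, hτ, Matrix.diagonal_mul_diagonal, Matrix.diagonal_mul_diagonal, Matrix.diagonal_sub]
    rw [h2, Matrix.add_apply, Matrix.sub_apply, Matrix.mul_apply, hτ, Matrix.mul_diagonal,
      Matrix.diagonal_mul]
    simp only [Matrix.mul_diagonal]
    exact h i l
  have h3 : (χ - Q) * τ - τ * (χ - Q) = 0 := by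
    have e : (χ - Q) * τ - τ * (χ - Q) = Q * (P * (χ * τ - τ * χ) * P + (P * τ - τ * P)) * Q := by
      have e1 : Q * (P * (χ * τ - τ * χ) * P + (P * τ - τ * P)) * Q =
        (Q * P) * (χ * τ - τ * χ) * (P * Q) + ((Q * P) * (τ * Q) - (Q * τ) * (P * Q)) := by
        noncomm_ring
      rw [e1, hPQ, hQP]; noncomm_ring
    rw [e, h1, mul_zero, zero_mul]
  have h4 := congrFun (congrFun h3 i) j
  rw [Matrix.sub_apply, hτ, Matrix.mul_diagonal, Matrix.diagonal_mul] at h4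
  exact sub_eq_zero.1 h4

section bdd
variable {K L : Type*} [CStarAlgebra K] [PartialOrder K] [StarOrderedRing K]
  [CStarAlgebra L] [PartialOrder L] [StarOrderedRing L]

theorem psi_bdd (Ψ : L →ₗ[ℂ] K)
    (hΨcp : ∀ (m : ℕ) (v : Fin m → L) (w : Fin m → K),
      0 ≤ ∑ i, ∑ j, star (w i) * Ψ (star (v i) * v j) * w j) :
    ∃ C : ℝ, 0 ≤ C ∧ ∀ y, ‖Ψ y‖ ≤ C * ‖y‖ := by
  have hpos : ∀ x, 0 ≤ x → 0 ≤ Ψ x := by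
    intro x hx
    obtain ⟨y, rfl⟩ := gen_nonneg x hx
    simpa using hΨcp 1 (fun _ => y) (fun _ => 1)
  obtain ⟨C, hC⟩ := PositiveLinearMap.exists_norm_apply_le (PositiveLinearMap.mk₀ Ψ hpos)
  exact ⟨C, C.2, hC⟩

open scoped ComplexOrder in
theorem F_mem {n : ℕ} (A : Subalgebra ℂ K) (hAclosed : IsClosed (A : Set K)) (hAstar : ∀ a ∈ A, star a ∈ A)
    (X : K)
    (AX : Subalgebra ℂ K) (hAX : AX = Algebra.adjoin ℂ ((A : Set K) ∪ {X}))
    (BY : Subalgebra ℂ L)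
    (DX : K →ₗ[ℂ] K ⊗[ℂ] K)
    (hDXder : ∀ x ∈ AX, ∀ y ∈ AX, DX (x * y) =
      LinearMap.rTensor K (LinearMap.mulLeft ℂ x) (DX y) +
      LinearMap.lTensor K (LinearMap.mulRight ℂ y) (DX x))
    (hDXA : ∀ a ∈ A, DX a = 0)
    (hDXX : DX X = (1 : K) ⊗ₜ[ℂ] (1 : K))
    (DY : L →ₗ[ℂ] L ⊗[ℂ] L)
    (hDYder : ∀ x ∈ BY, ∀ y ∈ BY, DY (x * y) =
      LinearMap.rTensor L (LinearMap.mulLeft ℂ x) (DY y) +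
      LinearMap.lTensor L (LinearMap.mulRight ℂ y) (DY x))
    (Ψ : L →ₗ[ℂ] K) (C : ℝ) (hC : 0 ≤ C) (hΨb : ∀ y, ‖Ψ y‖ ≤ C * ‖y‖)
    (hΨBY : ∀ y ∈ BY, Ψ y ∈ AX)
    (hΨcoalg : ∀ y ∈ BY, TensorProduct.map Ψ Ψ (DY y) = DX (Ψ y))
    (Z W V : CStarMatrix (Fin n) (Fin n) L)
    (hZ : ∀ i j, Z i j ∈ BY) (hW : ∀ i j, W i j ∈ BY)
    (hDZ : ∀ i j, DY (Z i j) = if i = j then (1 : L) ⊗ₜ[ℂ] (1 : L) else 0)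
    (hVZ : V * Z = 1) (hN : ‖1 - Z * W‖ < 1)
    (a a' : Matrix (Fin n) (Fin n) K) (ha : ∀ i j, a i j = Ψ (V i j))
    (haa : a * a' = 1) (haa' : a' * a = 1) (i j : Fin n) :
    (Matrix.diagonal (fun _ => X) - a' : Matrix (Fin n) (Fin n) K) i j ∈ A := by
  refine mem_of_commutant A hAclosed hAstar _ fun ω T hT => ?_
  let π : K →ₐ[ℂ] (ω.GNS →L[ℂ] ω.GNS) := ω.gnsStarAlgHom.toAlgHom
  have hπ : ∀ x, π x = ω.gnsStarAlgHom x := fun x => rfl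
  have hπn : ∀ x, ‖π x‖ ≤ ‖x‖ := fun x => by
    rw [hπ]; exact NonUnitalStarAlgHom.norm_apply_le _ x
  have hmap : (Matrix.diagonal (fun _ => X) - a' : Matrix (Fin n) (Fin n) K).map π =
      Matrix.diagonal (fun _ => π X) - a'.map π := by
    rw [Matrix.map_sub _ (map_sub π), Matrix.diagonal_map (map_zero π)]
  have hkey := comm_entries (a.map π) (a'.map π)
    (by rw [← Matrix.map_mul, haa, Matrix.map_one _ (map_zero π) (map_one π)])
    (by rw [← Matrix.map_mul, haa', Matrix.map_one _ (map_zero π) (map_one π)]) (π X) T ?_ i j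
  · rw [← hmap] at hkey
    exact hkey
  · intro i l
    have := core_comm (π.toLinearMap ∘ₗ Ψ) C hC (fun y => (hπn _).trans (hΨb y)) T
      (π X * T - T * π X) BY DY hDYder ?_ Z W V hZ hW hDZ hVZ hN i l
    · simpa [ha] using this
    · intro y hy
      have h1 := comm_eq_sandw π T A X AX hAX DX hDXder hDXA hDXX hT (Ψ y) (hΨBY y hy)
      rw [← hΨcoalg y hy, sandw_map] at h1
      exact h1
end bdd

section gen3
variable {R : Type*} [CStarAlgebra R] [PartialOrder R] [StarOrderedRing R]

theorem gen_im_sa (T : R) (ε : ℝ) :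
    star ((2 * Complex.I)⁻¹ • (T - star T) - (ε : ℂ) • (1 : R)) =
      (2 * Complex.I)⁻¹ • (T - star T) - (ε : ℂ) • (1 : R) := by
  rw [star_sub, star_smul, star_smul, star_sub, star_star, star_one]
  have h1 : star (2 * Complex.I)⁻¹ = -(2 * Complex.I)⁻¹ := by simp
  have h2 : star (ε : ℂ) = ε := by simp
  rw [h1, h2, neg_smul, ← smul_neg, neg_sub]

theorem gen_res (y b : R) (hy : star y = y) (ε : ℝ) (hε : 0 < ε)
    (h : (ε : ℂ) • (1 : R) ≤ (2 * Complex.I)⁻¹ • (b - star b)) :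
    ∃ V : R, (y - b) * V = 1 ∧ V * (y - b) = 1 ∧
      (∃ δ : ℝ, 0 < δ ∧ (δ : ℂ) • (1 : R) ≤ (2 * Complex.I)⁻¹ • (V - star V)) ∧
      ∃ c : ℝ, ‖1 - (y - b) * ((c : ℂ) • star (y - b))‖ < 1 := by
  have h' : (ε : ℂ) • (1 : R) ≤ (2 * Complex.I)⁻¹ • (-(y - b) - star (-(y - b))) := by
    convert h using 2
    rw [star_neg, star_sub, hy]; abel
  have hu : IsUnit (y - b) := by
    have := (isUnit_of_im _ ε hε h').neg
    rwa [neg_neg] at this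
  obtain ⟨u, hu⟩ := hu
  have e1 : (y - b) * (↑u⁻¹ : R) = 1 := by rw [← hu]; simp
  have e2 : (↑u⁻¹ : R) * (y - b) = 1 := by rw [← hu]; simp
  refine ⟨(↑u⁻¹ : R), e1, e2, im_inv _ _ e1 e2 ε hε h', ?_⟩
  have h2 := sub_im_ineq' _ ε hε h'
  obtain ⟨c, hc, hlt⟩ := contraction_of_ge _ (ε ^ 2) (by positivity) h2
  refine ⟨c, ?_⟩
  rwa [star_neg, neg_mul_neg, ← mul_smul_comm] at hlt

theorem gen_res2 (x a : R) (hx : star x = x) (ε : ℝ) (hε : 0 < ε)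
    (h : (ε : ℂ) • (1 : R) ≤ (2 * Complex.I)⁻¹ • (a - star a)) :
    ∃ V : R, a * V = 1 ∧ V * a = 1 ∧
      ∃ δ : ℝ, 0 < δ ∧ 0 ≤ (2 * Complex.I)⁻¹ • ((x - V) - star (x - V)) - (δ : ℂ) • (1 : R) := by
  obtain ⟨u, hu⟩ := isUnit_of_im _ ε hε h
  have e1 : a * (↑u⁻¹ : R) = 1 := by rw [← hu]; simp
  have e2 : (↑u⁻¹ : R) * a = 1 := by rw [← hu]; simp
  refine ⟨(↑u⁻¹ : R), e1, e2, ?_⟩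
  obtain ⟨δ, hδ, h3⟩ := im_inv (-a) (-(↑u⁻¹ : R)) (by rw [neg_mul_neg, e1]) (by rw [neg_mul_neg, e2]) ε hε
    (by rwa [neg_neg])
  refine ⟨δ, hδ, sub_nonneg.2 ?_⟩
  convert h3 using 2
  rw [star_neg, star_sub, hx]; abel

theorem gen_le (a b : R) (h : 0 ≤ a - b) : b ≤ a := sub_nonneg.1 h
theorem gen_le' (a b : R) (h : b ≤ a) : 0 ≤ a - b := sub_nonneg.2 h
end gen3

section point
variable {K L : Type*} [CStarAlgebra K] [PartialOrder K] [StarOrderedRing K]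
  [CStarAlgebra L] [PartialOrder L] [StarOrderedRing L]

theorem point_main {n : ℕ}
    (A : Subalgebra ℂ K) (hAclosed : IsClosed (A : Set K)) (hAstar : ∀ a ∈ A, star a ∈ A)
    (B : Subalgebra ℂ L) (hBstar : ∀ b ∈ B, star b ∈ B)
    (X : K) (hX : IsSelfAdjoint X)
    (Y : L) (hY : IsSelfAdjoint Y)
    (AX : Subalgebra ℂ K) (hAX : AX = Algebra.adjoin ℂ ((A : Set K) ∪ {X}))
    (BY : Subalgebra ℂ L) (hBY : BY = Algebra.adjoin ℂ ((B : Set L) ∪ {Y}))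
    (DX : K →ₗ[ℂ] K ⊗[ℂ] K)
    (hDXder : ∀ x ∈ AX, ∀ y ∈ AX, DX (x * y) =
      LinearMap.rTensor K (LinearMap.mulLeft ℂ x) (DX y) +
      LinearMap.lTensor K (LinearMap.mulRight ℂ y) (DX x))
    (hDXA : ∀ a ∈ A, DX a = 0)
    (hDXX : DX X = (1 : K) ⊗ₜ[ℂ] (1 : K))
    (DY : L →ₗ[ℂ] L ⊗[ℂ] L)
    (hDYder : ∀ x ∈ BY, ∀ y ∈ BY, DY (x * y) =
      LinearMap.rTensor L (LinearMap.mulLeft ℂ x) (DY y) +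
      LinearMap.lTensor L (LinearMap.mulRight ℂ y) (DY x))
    (hDYB : ∀ b ∈ B, DY b = 0)
    (hDYY : DY Y = (1 : L) ⊗ₜ[ℂ] (1 : L))
    (Ψ : L →ₗ[ℂ] K) (hΨ1 : Ψ 1 = 1) (hΨstar : ∀ x : L, Ψ (star x) = star (Ψ x))
    (hΨcp : ∀ (m : ℕ) (v : Fin m → L) (w : Fin m → K),
      0 ≤ ∑ i, ∑ j, star (w i) * Ψ (star (v i) * v j) * w j)
    (hΨBY : ∀ y ∈ BY, Ψ y ∈ AX)
    (hΨcoalg : ∀ y ∈ BY, TensorProduct.map Ψ Ψ (DY y) = DX (Ψ y))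
    (β : Matrix (Fin n) (Fin n) L) (hβ : β ∈ matUpperHalfPlane L B) :
    ∃ (V : Matrix (Fin n) (Fin n) L) (a' : Matrix (Fin n) (Fin n) K),
      (Y • (1 : Matrix (Fin n) (Fin n) L) - β) * V = 1 ∧
      V * (Y • (1 : Matrix (Fin n) (Fin n) L) - β) = 1 ∧
      V.map Ψ * a' = 1 ∧ a' * V.map Ψ = 1 ∧
      X • (1 : Matrix (Fin n) (Fin n) K) - a' ∈ matUpperHalfPlane K A := by
  obtain ⟨hβB, ε, hε, hpos⟩ := hβ
  let b : CStarMatrix (Fin n) (Fin n) L := CStarMatrix.ofMatrix β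
  let y : CStarMatrix (Fin n) (Fin n) L := CStarMatrix.ofMatrix (Y • (1 : Matrix (Fin n) (Fin n) L))
  let x : CStarMatrix (Fin n) (Fin n) K := CStarMatrix.ofMatrix (X • (1 : Matrix (Fin n) (Fin n) K))
  have hyij : ∀ i j, y i j = if i = j then Y else 0 := by
    intro i j
    change (Y • (1 : Matrix (Fin n) (Fin n) L)) i j = _
    rw [Matrix.smul_apply, Matrix.one_apply]; split_ifs <;> simp
  have hxij : ∀ i j, x i j = if i = j then X else 0 := by
    intro i j
    change (X • (1 : Matrix (Fin n) (Fin n) K)) i j = _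
    rw [Matrix.smul_apply, Matrix.one_apply]; split_ifs <;> simp
  have hy : star y = y := by
    ext i j
    rw [CStarMatrix.star_apply, hyij, hyij]
    by_cases h : i = j
    · simp [h, hY.star_eq]
    · simp [h, Ne.symm h]
  have hx : star x = x := by
    ext i j
    rw [CStarMatrix.star_apply, hxij, hxij]
    by_cases h : i = j
    · simp [h, hX.star_eq]
    · simp [h, Ne.symm h]
  have h1 := nonneg_of_matNonneg _ (gen_im_sa b ε) hpos
  obtain ⟨V, hZV, hVZ, ⟨δ, hδ, hVδ⟩, c, hc⟩ := gen_res y b hy ε hε (gen_le _ _ h1)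
  have h2 := map_nonneg_of_cp Ψ hΨstar hΨcp _ (gen_le' _ _ hVδ)
  have h3 : ((2 * Complex.I)⁻¹ • (V - star V) - (δ : ℂ) • (1 : CStarMatrix (Fin n) (Fin n) L)).map Ψ =
      (2 * Complex.I)⁻¹ • (V.map Ψ - star (V.map Ψ)) - (δ : ℂ) • (1 : CStarMatrix (Fin n) (Fin n) K) := by
    ext i j
    simp only [CStarMatrix.map_apply, CStarMatrix.sub_apply, CStarMatrix.smul_apply, CStarMatrix.star_apply,
      map_sub, map_smul, hΨstar, CStarMatrix.one_apply]
    split_ifs <;> simp [hΨ1]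
  rw [h3] at h2
  obtain ⟨a', ha1, ha2, δ', hδ', h4⟩ := gen_res2 x (V.map Ψ) hx δ hδ (gen_le _ _ h2)
  obtain ⟨C, hC, hΨb⟩ := psi_bdd Ψ hΨcp
  have hBle : ∀ z ∈ B, z ∈ BY := fun z hz => by rw [hBY]; exact Algebra.subset_adjoin (Or.inl hz)
  have hYBY : Y ∈ BY := by rw [hBY]; exact Algebra.subset_adjoin (Or.inr rfl)
  have hyBY : ∀ i j, y i j ∈ BY := by
    intro i j; rw [hyij]; split_ifs
    · exact hYBY
    · exact BY.zero_mem
  refine ⟨V, a', hZV, hVZ, ha1, ha2, ?_, δ', hδ', matNonneg_of_nonneg _ h4⟩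
  intro i j
  have hxd : X • (1 : Matrix (Fin n) (Fin n) K) = Matrix.diagonal (fun _ => X) := by
    ext i j
    rw [Matrix.smul_apply, Matrix.one_apply, Matrix.diagonal_apply]; split_ifs <;> simp
  rw [hxd]
  refine F_mem A hAclosed hAstar X AX hAX BY DX hDXder hDXA hDXX DY hDYder Ψ C hC hΨb hΨBY hΨcoalg
    (y - b) ((c : ℂ) • star (y - b)) V ?_ ?_ ?_ hVZ hc (V.map Ψ) a' (fun _ _ => rfl) ha1 ha2 i j
  · intro i j
    exact BY.sub_mem (hyBY i j) (hBle _ (hβB i j))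
  · intro i j
    rw [star_sub, hy]
    refine BY.smul_mem (BY.sub_mem (hyBY i j) (hBle _ ?_)) _
    exact hBstar _ (hβB j i)
  · intro i j
    rw [CStarMatrix.sub_apply, map_sub, hDYB (b i j) (hβB i j), hyij, sub_zero]
    split_ifs <;> simp [hDYY]
end point

theorem gen_diff {R₁ R₂ : Type*} [NormedRing R₁] [NormedAlgebra ℂ R₁] [CompleteSpace R₁]
    [NormedRing R₂] [NormedAlgebra ℂ R₂] [CompleteSpace R₂] (φ : R₁ →L[ℂ] R₂) (y : R₁) (x : R₂)
    (β : R₁) (h1 : IsUnit (y - β)) (h2 : IsUnit (φ (Ring.inverse (y - β)))) :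
    DifferentiableAt ℂ (fun β => x - Ring.inverse (φ (Ring.inverse (y - β)))) β := by
  have d1 : DifferentiableAt ℂ (fun β => Ring.inverse (y - β)) β :=
    DifferentiableAt.comp β (differentiableAt_inverse h1) (by fun_prop)
  have d2 : DifferentiableAt ℂ (fun β => φ (Ring.inverse (y - β))) β :=
    φ.differentiableAt.comp β d1
  have d3 : DifferentiableAt ℂ (fun β => Ring.inverse (φ (Ring.inverse (y - β)))) β :=
    DifferentiableAt.comp (g := Ring.inverse) β (differentiableAt_inverse h2) d2
  exact d3.const_sub x

theorem mat_diff {K L : Type*} [NormedRing K] [NormedAlgebra ℂ K] [CompleteSpace K]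
    [NormedRing L] [NormedAlgebra ℂ L] [CompleteSpace L] {n : ℕ}
    (Ψ : L →ₗ[ℂ] K) (C : ℝ) (hΨ : ∀ y, ‖Ψ y‖ ≤ C * ‖y‖)
    (y : Matrix (Fin n) (Fin n) L) (x : Matrix (Fin n) (Fin n) K) (β : Matrix (Fin n) (Fin n) L)
    (h1 : IsUnit (y - β)) (h2 : IsUnit ((Ring.inverse (y - β)).map Ψ)) :
    DifferentiableAt ℂ (fun β => x - Ring.inverse ((Ring.inverse (y - β)).map Ψ)) β := by
  let i1 : NormedRing (Matrix (Fin n) (Fin n) L) := Matrix.linftyOpNormedRing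
  let i2 : NormedRing (Matrix (Fin n) (Fin n) K) := Matrix.linftyOpNormedRing
  let i3 : NormedAlgebra ℂ (Matrix (Fin n) (Fin n) L) := Matrix.linftyOpNormedAlgebra
  let i4 : NormedAlgebra ℂ (Matrix (Fin n) (Fin n) K) := Matrix.linftyOpNormedAlgebra
  have ci1 : @CompleteSpace (Matrix (Fin n) (Fin n) L) i1.toMetricSpace.toPseudoMetricSpace.toUniformSpace :=
    inferInstanceAs (CompleteSpace (Fin n → Fin n → L))
  have ci2 : @CompleteSpace (Matrix (Fin n) (Fin n) K) i2.toMetricSpace.toPseudoMetricSpace.toUniformSpace :=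
    inferInstanceAs (CompleteSpace (Fin n → Fin n → K))
  have hc : Continuous Ψ := (Ψ.mkContinuous C hΨ).continuous
  let φ : Matrix (Fin n) (Fin n) L →L[ℂ] Matrix (Fin n) (Fin n) K :=
    ⟨Ψ.mapMatrix, by
      refine continuous_pi fun i => continuous_pi fun j => ?_
      exact hc.comp ((continuous_apply j).comp (continuous_apply i))⟩
  exact gen_diff φ y x β h1 h2

theorem ring_inverse_of_two {M : Type*} [Ring M] (a b : M) (h1 : a * b = 1) (h2 : b * a = 1) :
    Ring.inverse a = b := Ring.inverse_unit (⟨a, b, h1, h2⟩ : Mˣ)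

theorem isUnit_of_two {M : Type*} [Ring M] (a b : M) (h1 : a * b = 1) (h2 : b * a = 1) :
    IsUnit a := ⟨⟨a, b, h1, h2⟩, rfl⟩

/-- Theorem 4.4 (analytic subordination for completely positive coalgebra morphisms):
let `K, L` be unital C*-algebras with C*-subalgebras `A ⊆ K`, `B ⊆ L`; `X = X* ∈ K`
algebraically free from `A`, `Y = Y* ∈ L` algebraically free from `B`; `Ψ : L → K` a
unital completely positive map with `Ψ(B⟨Y⟩) ⊆ A⟨X⟩` and
`(Ψ ⊗ Ψ) ∘ ∂_{Y:B} = ∂_{X:A} ∘ Ψ` on `B⟨Y⟩`, where `∂_{X:A}` and `∂_{Y:B}` are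
norm-closable.  Then for each `n` there is a holomorphic map
`Fₙ : H₊(Mₙ(B)) → H₊(Mₙ(A))` such that
`Mₙ(Ψ)((Y ⊗ Iₙ − β)⁻¹) = (X ⊗ Iₙ − Fₙ(β))⁻¹` for all `β ∈ H₊(Mₙ(B))`. -/
theorem subordination_cp_coalgebra_morphism
    {K L : Type*}
    [NormedRing K] [StarRing K] [CStarRing K] [NormedAlgebra ℂ K] [StarModule ℂ K]
    [CompleteSpace K] [PartialOrder K] [StarOrderedRing K]
    [NormedRing L] [StarRing L] [CStarRing L] [NormedAlgebra ℂ L] [StarModule ℂ L]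
    [CompleteSpace L] [PartialOrder L] [StarOrderedRing L]
    (A : Subalgebra ℂ K) (hAclosed : IsClosed (A : Set K)) (hAstar : ∀ a ∈ A, star a ∈ A)
    (B : Subalgebra ℂ L) (hBclosed : IsClosed (B : Set L)) (hBstar : ∀ b ∈ B, star b ∈ B)
    (X : K) (hX : IsSelfAdjoint X)
    (Y : L) (hY : IsSelfAdjoint Y)
    (AX : Subalgebra ℂ K) (hAX : AX = Algebra.adjoin ℂ ((A : Set K) ∪ {X}))
    (BY : Subalgebra ℂ L) (hBY : BY = Algebra.adjoin ℂ ((B : Set L) ∪ {Y}))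
    -- the free difference quotients `∂_{X:A}` and `∂_{Y:B}`
    (DX : K →ₗ[ℂ] K ⊗[ℂ] K)
    (hDXder : ∀ x ∈ AX, ∀ y ∈ AX, DX (x * y) =
      LinearMap.rTensor K (LinearMap.mulLeft ℂ x) (DX y) +
      LinearMap.lTensor K (LinearMap.mulRight ℂ y) (DX x))
    (hDXA : ∀ a ∈ A, DX a = 0)
    (hDXX : DX X = (1 : K) ⊗ₜ[ℂ] (1 : K))
    (DY : L →ₗ[ℂ] L ⊗[ℂ] L)
    (hDYder : ∀ x ∈ BY, ∀ y ∈ BY, DY (x * y) =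
      LinearMap.rTensor L (LinearMap.mulLeft ℂ x) (DY y) +
      LinearMap.lTensor L (LinearMap.mulRight ℂ y) (DY x))
    (hDYB : ∀ b ∈ B, DY b = 0)
    (hDYY : DY Y = (1 : L) ⊗ₜ[ℂ] (1 : L))
    -- `∂_{X:A}` and `∂_{Y:B}` are closable in norm
    (hDXclosable : ∀ (x : ℕ → K) (y : K ⊗[ℂ] K), (∀ n, x n ∈ AX) →
      Tendsto x atTop (𝓝 0) →
      Tendsto (fun n => projNorm K (DX (x n) - y)) atTop (𝓝 0) →
      projNorm K y = 0)
    (hDYclosable : ∀ (x : ℕ → L) (y : L ⊗[ℂ] L), (∀ n, x n ∈ BY) →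
      Tendsto x atTop (𝓝 0) →
      Tendsto (fun n => projNorm L (DY (x n) - y)) atTop (𝓝 0) →
      projNorm L y = 0)
    -- `Ψ` is a unital completely positive linear map
    (Ψ : L →ₗ[ℂ] K) (hΨ1 : Ψ 1 = 1) (hΨstar : ∀ x : L, Ψ (star x) = star (Ψ x))
    (hΨcp : ∀ (m : ℕ) (v : Fin m → L) (w : Fin m → K),
      0 ≤ ∑ i, ∑ j, star (w i) * Ψ (star (v i) * v j) * w j)
    -- `Ψ(B⟨Y⟩) ⊆ A⟨X⟩` and `(Ψ ⊗ Ψ) ∘ ∂_{Y:B} = ∂_{X:A} ∘ Ψ` on `B⟨Y⟩`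
    (hΨBY : ∀ y ∈ BY, Ψ y ∈ AX)
    (hΨcoalg : ∀ y ∈ BY, TensorProduct.map Ψ Ψ (DY y) = DX (Ψ y)) :
    ∀ n : ℕ, ∃ F : Matrix (Fin n) (Fin n) L → Matrix (Fin n) (Fin n) K,
      (∀ β ∈ matUpperHalfPlane L B, F β ∈ matUpperHalfPlane K A) ∧
      DifferentiableOn ℂ F (matUpperHalfPlane L B) ∧
      ∀ β ∈ matUpperHalfPlane L B,
        IsUnit (Y • (1 : Matrix (Fin n) (Fin n) L) - β) ∧
        IsUnit (X • (1 : Matrix (Fin n) (Fin n) K) - F β) ∧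
        (Ring.inverse (Y • (1 : Matrix (Fin n) (Fin n) L) - β)).map Ψ =
          Ring.inverse (X • (1 : Matrix (Fin n) (Fin n) K) - F β) := by
  let : CStarAlgebra K := {}
  let : CStarAlgebra L := {}
  intro n
  have key := fun (β : Matrix (Fin n) (Fin n) L) (hβ : β ∈ matUpperHalfPlane L B) =>
    point_main A hAclosed hAstar B hBstar X hX Y hY AX hAX BY hBY DX hDXder hDXA hDXX DY hDYder
      hDYB hDYY Ψ hΨ1 hΨstar hΨcp hΨBY hΨcoalg β hβ
  obtain ⟨C, hC, hΨb⟩ := psi_bdd Ψ hΨcp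
  refine ⟨fun β => X • (1 : Matrix (Fin n) (Fin n) K) -
    Ring.inverse ((Ring.inverse (Y • (1 : Matrix (Fin n) (Fin n) L) - β)).map Ψ), ?_, ?_, ?_⟩
  · intro β hβ
    obtain ⟨V, a', h1, h2, h3, h4, h5⟩ := key β hβ
    simp only [ring_inverse_of_two _ _ h1 h2, ring_inverse_of_two _ _ h3 h4]
    exact h5
  · intro β hβ
    obtain ⟨V, a', h1, h2, h3, h4, h5⟩ := key β hβ
    refine DifferentiableAt.differentiableWithinAt (mat_diff Ψ C hΨb _ _ β (isUnit_of_two _ _ h1 h2) ?_)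
    rw [ring_inverse_of_two _ _ h1 h2]
    exact isUnit_of_two _ _ h3 h4
  · intro β hβ
    obtain ⟨V, a', h1, h2, h3, h4, h5⟩ := key β hβ
    simp only [ring_inverse_of_two _ _ h1 h2, ring_inverse_of_two _ _ h3 h4, sub_sub_cancel,
      ring_inverse_of_two _ _ h4 h3]
    exact ⟨isUnit_of_two _ _ h1 h2, isUnit_of_two _ _ h4 h3, trivial⟩
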